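/- Under the stated hypotheses, let ρ ∈ ℕ, let U be a real symmetric positive semidefinite n×n matrix, and suppose Y ∈ ℝ^{ρdn×ρdn} symmetric and X = [X₁ ⋯ X_d] ∈ ℝ^{n×ρdn} (with blocks X_i ∈ ℝ^{n×ρn}) satisfy that the block matrix [[U, −X], [−Xᵀ, Y]] is positive semidefinite. Set X̂ := Col(X₁, …, X_d) ∈ ℝ^{dn×ρn} and W := ∫_K ϖ(τ) (f(τ)ᵀ ⊗ I_{ρn}) Y (f(τ) ⊗ I_{ρn}) dτ. If Υ ∈ ℝ^{dn×ρn} and z ∈ ℝ^{ρn} satisfy Υ z = ϑ, then ∫_K ϖ(τ) x(τ)ᵀ U x(τ) dτ ≥ zᵀ (Υᵀ X̂ + X̂ᵀ Υ − W) z. -/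

import Mathlib

open MeasureTheory Matrix
open scoped Kronecker

/-- `Fₙ(τ) = f(τ) ⊗ Iₙ ∈ ℝ^{dn×n}`. -/
noncomputable def kronColId (d n : ℕ) (f : ℝ → Fin d → ℝ) (τ : ℝ) :
    Matrix (Fin d × Fin n) (Fin n) ℝ :=
  Matrix.of fun p j => f τ p.1 * (1 : Matrix (Fin n) (Fin n) ℝ) p.2 j

/-- `f(τ) ⊗ I_{ρn} ∈ ℝ^{dρn×ρn}`. -/
noncomputable def kronColIdRho (d n ρ : ℕ) (f : ℝ → Fin d → ℝ) (τ : ℝ) :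
    Matrix (Fin d × (Fin ρ × Fin n)) (Fin ρ × Fin n) ℝ :=
  Matrix.of fun p q => f τ p.1 * (1 : Matrix (Fin ρ × Fin n) (Fin ρ × Fin n) ℝ) p.2 q

lemma aux_int (K : Set ℝ) (ϖ : ℝ → ℝ) (hϖ : Measurable ϖ) (hϖ0 : ∀ τ, 0 ≤ ϖ τ)
    {m n : ℕ} (f : ℝ → Fin m → ℝ) (hf : Measurable f)
    (hfi : IntegrableOn (fun τ => ϖ τ * ‖f τ‖ ^ 2) K)
    (g : ℝ → Fin n → ℝ) (hg : Measurable g)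
    (hgi : IntegrableOn (fun τ => ϖ τ * ‖g τ‖ ^ 2) K) (i : Fin m) (j : Fin n) :
    IntegrableOn (fun τ => ϖ τ * (f τ i * g τ j)) K := by
  refine Integrable.mono' (hfi.add hgi) ?_ ?_
  · have h1 : Measurable fun τ => f τ i := (measurable_pi_apply i).comp hf
    have h2 : Measurable fun τ => g τ j := (measurable_pi_apply j).comp hg
    exact (hϖ.mul (h1.mul h2)).aestronglyMeasurable
  · refine Filter.Eventually.of_forall fun τ => ?_
    have a := norm_le_pi_norm (f τ) i
    have b := norm_le_pi_norm (g τ) j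
    have h0 := hϖ0 τ
    simp only [Pi.add_apply, norm_mul]
    rw [Real.norm_of_nonneg h0, ← mul_add]
    apply mul_le_mul_of_nonneg_left _ h0
    have c : ‖f τ i‖ * ‖g τ j‖ ≤ ‖f τ‖ * ‖g τ‖ := by gcongr
    nlinarith [sq_nonneg (‖f τ‖ - ‖g τ‖), sq_nonneg (‖f τ‖ + ‖g τ‖)]

lemma aux_split (K : Set ℝ) (a b c : ℝ → ℝ) (ha : IntegrableOn a K) (hb : IntegrableOn b K)
    (hc : IntegrableOn c K) : ∫ τ in K, (a τ - 2 * b τ + c τ) =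
      (∫ τ in K, a τ) - 2 * (∫ τ in K, b τ) + ∫ τ in K, c τ := by
  have h1 : IntegrableOn (fun τ => 2 * b τ) K := hb.const_mul 2
  have h2 : IntegrableOn (fun τ => a τ - 2 * b τ) K := ha.sub h1
  rw [integral_add h2 hc, integral_sub ha h1, integral_const_mul]

lemma aux_mulVec (d n : ℕ) (f : ℝ → Fin d → ℝ) (τ : ℝ) (x : Fin n → ℝ) (p : Fin d × Fin n) :
    (kronColId d n f τ *ᵥ x) p = f τ p.1 * x p.2 := by
  simp [kronColId, Matrix.mulVec, dotProduct, Matrix.one_apply]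

lemma aux_mulVecRho (d n ρ : ℕ) (f : ℝ → Fin d → ℝ) (τ : ℝ) (z : Fin ρ × Fin n → ℝ)
    (p : Fin d × (Fin ρ × Fin n)) :
    (kronColIdRho d n ρ f τ *ᵥ z) p = f τ p.1 * z p.2 := by
  simp [kronColIdRho, Matrix.mulVec, dotProduct, Matrix.one_apply]

lemma aux_conj (d n ρ : ℕ) (f : ℝ → Fin d → ℝ) (τ : ℝ)
    (Y : Matrix (Fin d × (Fin ρ × Fin n)) (Fin d × (Fin ρ × Fin n)) ℝ) (a b : Fin ρ × Fin n) :
    ((kronColIdRho d n ρ f τ)ᵀ * Y * kronColIdRho d n ρ f τ) a b =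
      ∑ j, ∑ i, f τ i * f τ j * Y (i, a) (j, b) := by
  simp only [Matrix.mul_apply, kronColIdRho, Matrix.transpose_apply, Matrix.of_apply,
    Matrix.one_apply]
  rw [Fintype.sum_prod_type]
  refine Finset.sum_congr rfl fun j _ => ?_
  simp only [mul_ite, mul_one, mul_zero, Finset.sum_ite_eq', Finset.mem_univ, if_true]
  rw [Fintype.sum_prod_type, Finset.sum_mul]
  refine Finset.sum_congr rfl fun i _ => ?_
  simp only [ite_mul, zero_mul, Finset.sum_ite_eq', Finset.mem_univ, if_true]
  ring

/-- Free-matrix type integral inequality: if `[[U, −X], [−Xᵀ, Y]] ⪰ 0` and `Υ z = ϑ`,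
then `∫_K ϖ xᵀ U x ≥ zᵀ (Υᵀ X̂ + X̂ᵀ Υ − W) z`. -/
theorem free_matrix_integral_inequality_with_relation (d n ρ : ℕ) (K : Set ℝ)
    (hK : MeasurableSet K)
    (ϖ : ℝ → ℝ) (hϖ : Measurable ϖ) (hϖ0 : ∀ τ, 0 ≤ ϖ τ)
    (f : ℝ → Fin d → ℝ) (hf : Measurable f)
    (hfi : IntegrableOn (fun τ => ϖ τ * ‖f τ‖ ^ 2) K)
    (W₀ : Matrix (Fin d) (Fin d) ℝ)
    (hW₀ : W₀ = Matrix.of fun i j => ∫ τ in K, ϖ τ * (f τ i * f τ j))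
    (hW₀pd : W₀.PosDef)
    (x : ℝ → Fin n → ℝ) (hx : Measurable x)
    (hxi : IntegrableOn (fun τ => ϖ τ * ‖x τ‖ ^ 2) K)
    (ϑ : Fin d × Fin n → ℝ)
    (hϑ : ϑ = fun p => ∫ τ in K, ϖ τ * ((kronColId d n f τ *ᵥ x τ) p))
    (U : Matrix (Fin n) (Fin n) ℝ) (hU : U.PosSemidef)
    (Y : Matrix (Fin d × (Fin ρ × Fin n)) (Fin d × (Fin ρ × Fin n)) ℝ)
    (hY : Y.IsSymm)
    (Xb : Fin d → Matrix (Fin n) (Fin ρ × Fin n) ℝ)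
    (X : Matrix (Fin n) (Fin d × (Fin ρ × Fin n)) ℝ)
    (hX : X = Matrix.of fun i q => Xb q.1 i q.2)
    (hblock : (Matrix.fromBlocks U (-X) (-Xᵀ) Y).PosSemidef)
    (Xhat : Matrix (Fin d × Fin n) (Fin ρ × Fin n) ℝ)
    (hXhat : Xhat = Matrix.of fun p q => Xb p.1 p.2 q)
    (W : Matrix (Fin ρ × Fin n) (Fin ρ × Fin n) ℝ)
    (hW : W = Matrix.of fun a b => ∫ τ in K,
      ϖ τ * (((kronColIdRho d n ρ f τ)ᵀ * Y * kronColIdRho d n ρ f τ) a b))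
    (Υ : Matrix (Fin d × Fin n) (Fin ρ × Fin n) ℝ)
    (z : Fin ρ × Fin n → ℝ) (hΥz : Υ *ᵥ z = ϑ) :
    (∫ τ in K, ϖ τ * (x τ ⬝ᵥ U *ᵥ x τ)) ≥
      z ⬝ᵥ (Υᵀ * Xhat + Xhatᵀ * Υ - W) *ᵥ z := by
  have hxx := aux_int K ϖ hϖ hϖ0 x hx hxi x hx hxi
  have hfx := aux_int K ϖ hϖ hϖ0 f hf hfi x hx hxi
  have hff := aux_int K ϖ hϖ hϖ0 f hf hfi f hf hfi
  have I1 : IntegrableOn (fun τ => ϖ τ * (x τ ⬝ᵥ U *ᵥ x τ)) K := by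
    have : (fun τ => ϖ τ * (x τ ⬝ᵥ U *ᵥ x τ)) =
        fun τ => ∑ i, ∑ j, (ϖ τ * (x τ i * x τ j)) * U i j := by
      funext τ
      simp only [dotProduct, Matrix.mulVec, Finset.mul_sum]
      refine Finset.sum_congr rfl fun i _ => Finset.sum_congr rfl fun j _ => ?_
      ring
    rw [this]
    exact integrable_finsetSum _ fun i _ => integrable_finsetSum _ fun j _ =>
      (hxx i j).mul_const _
  have J2 : ∀ p, IntegrableOn (fun τ => ϖ τ * ((kronColId d n f τ *ᵥ x τ) p)) K := by
    intro p
    simp only [aux_mulVec]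
    exact hfx p.1 p.2
  have J3 : ∀ a b, IntegrableOn (fun τ =>
      ϖ τ * (((kronColIdRho d n ρ f τ)ᵀ * Y * kronColIdRho d n ρ f τ) a b)) K := by
    intro a b
    simp only [aux_conj, Finset.mul_sum]
    refine integrable_finsetSum _ fun j _ => integrable_finsetSum _ fun i _ => ?_
    have := (hff i j).mul_const (Y (i, a) (j, b))
    simpa only [mul_assoc] using this
  have H2 : Integrable (fun τ => ∑ p, (ϖ τ * ((kronColId d n f τ *ᵥ x τ) p)) * (Xhat *ᵥ z) p)
      (volume.restrict K) :=
    integrable_finsetSum _ fun p _ => (J2 p).mul_const _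
  have E2 : ∫ τ in K, ∑ p, (ϖ τ * ((kronColId d n f τ *ᵥ x τ) p)) * (Xhat *ᵥ z) p =
      ϑ ⬝ᵥ Xhat *ᵥ z := by
    rw [integral_finsetSum _ fun p _ => (J2 p).mul_const _]
    simp only [integral_mul_const, dotProduct, hϑ]
  have H3 : Integrable (fun τ => ∑ a, ∑ b, (ϖ τ *
      (((kronColIdRho d n ρ f τ)ᵀ * Y * kronColIdRho d n ρ f τ) a b)) * (z a * z b))
      (volume.restrict K) :=
    integrable_finsetSum _ fun a _ => integrable_finsetSum _ fun b _ => (J3 a b).mul_const _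
  have E3 : ∫ τ in K, ∑ a, ∑ b, (ϖ τ *
      (((kronColIdRho d n ρ f τ)ᵀ * Y * kronColIdRho d n ρ f τ) a b)) * (z a * z b) =
      z ⬝ᵥ W *ᵥ z := by
    rw [integral_finsetSum _ fun a _ => integrable_finsetSum _ fun b _ => (J3 a b).mul_const _]
    simp only [dotProduct, Matrix.mulVec, Finset.mul_sum]
    refine Finset.sum_congr rfl fun a _ => ?_
    rw [integral_finsetSum _ fun b _ => (J3 a b).mul_const _]
    refine Finset.sum_congr rfl fun b _ => ?_
    rw [integral_mul_const, hW, Matrix.of_apply]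
    ring
  have key : 0 ≤ ∫ τ in K, (ϖ τ * (x τ ⬝ᵥ U *ᵥ x τ)
      - 2 * ∑ p, (ϖ τ * ((kronColId d n f τ *ᵥ x τ) p)) * (Xhat *ᵥ z) p
      + ∑ a, ∑ b, (ϖ τ *
      (((kronColIdRho d n ρ f τ)ᵀ * Y * kronColIdRho d n ρ f τ) a b)) * (z a * z b)) := by
    refine integral_nonneg fun τ => ?_
    have hq := hblock.dotProduct_mulVec_nonneg (Sum.elim (x τ) (kronColIdRho d n ρ f τ *ᵥ z))
    have h2 : ∑ p, (ϖ τ * ((kronColId d n f τ *ᵥ x τ) p)) * (Xhat *ᵥ z) p =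
        ϖ τ * (x τ ⬝ᵥ X *ᵥ (kronColIdRho d n ρ f τ *ᵥ z)) := by
      simp only [dotProduct, aux_mulVec]
      rw [Fintype.sum_prod_type, Finset.sum_comm, Finset.mul_sum]
      refine Finset.sum_congr rfl fun k _ => ?_
      simp only [Matrix.mulVec, dotProduct, hX, hXhat, Matrix.of_apply]
      have := aux_mulVecRho d n ρ f τ z
      simp only [Matrix.mulVec, dotProduct] at this
      simp only [this]
      rw [Fintype.sum_prod_type (α₁ := Fin d)]
      simp only [Finset.mul_sum]
      refine Finset.sum_congr rfl fun i _ => Finset.sum_congr rfl fun q _ => ?_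
      ring
    have h3 : ∑ a, ∑ b, (ϖ τ *
        (((kronColIdRho d n ρ f τ)ᵀ * Y * kronColIdRho d n ρ f τ) a b)) * (z a * z b) =
        ϖ τ * ((kronColIdRho d n ρ f τ *ᵥ z) ⬝ᵥ Y *ᵥ (kronColIdRho d n ρ f τ *ᵥ z)) := by
      have : (kronColIdRho d n ρ f τ *ᵥ z) ⬝ᵥ Y *ᵥ (kronColIdRho d n ρ f τ *ᵥ z) =
          z ⬝ᵥ ((kronColIdRho d n ρ f τ)ᵀ * Y * kronColIdRho d n ρ f τ) *ᵥ z := by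
        rw [← Matrix.mulVec_mulVec, ← Matrix.mulVec_mulVec, Matrix.dotProduct_mulVec z,
          Matrix.vecMul_transpose]
      rw [this]
      generalize (kronColIdRho d n ρ f τ)ᵀ * Y * kronColIdRho d n ρ f τ = M
      simp only [dotProduct, Matrix.mulVec, Finset.mul_sum]
      refine Finset.sum_congr rfl fun a _ => Finset.sum_congr rfl fun b _ => ?_
      ring
    rw [h2, h3]
    generalize kronColIdRho d n ρ f τ *ᵥ z = y at hq ⊢
    have hs : y ⬝ᵥ Xᵀ *ᵥ x τ = x τ ⬝ᵥ X *ᵥ y := by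
      rw [Matrix.dotProduct_mulVec, Matrix.vecMul_transpose, dotProduct_comm]
    rw [star_trivial, Matrix.fromBlocks_mulVec, sumElim_dotProduct_sumElim] at hq
    simp only [Sum.elim_comp_inl, Sum.elim_comp_inr, Matrix.neg_mulVec, dotProduct_add,
      dotProduct_neg, hs] at hq
    have := mul_nonneg (hϖ0 τ) hq
    simp only [Pi.zero_apply]
    linarith
  have key2 := key.trans_eq (aux_split K _ _ _ I1 H2 H3)
  rw [E2, E3] at key2
  have e1 : z ⬝ᵥ (Υᵀ * Xhat) *ᵥ z = ϑ ⬝ᵥ Xhat *ᵥ z := by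
    rw [← Matrix.mulVec_mulVec, Matrix.dotProduct_mulVec, Matrix.vecMul_transpose, hΥz]
  have e2 : z ⬝ᵥ (Xhatᵀ * Υ) *ᵥ z = ϑ ⬝ᵥ Xhat *ᵥ z := by
    rw [← Matrix.mulVec_mulVec, Matrix.dotProduct_mulVec, Matrix.vecMul_transpose, hΥz,
      dotProduct_comm]
  rw [Matrix.sub_mulVec, Matrix.add_mulVec, dotProduct_sub, dotProduct_add, e1, e2]
  linarith
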